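/- Let V ∈ L¹(ℝ³) with V ≥ 0 almost everywhere, and let 0 < z₁ < z₂. Then ∫_{ℝ³} ∫_{ℝ³} V(x) V(x') [ (e^{-z₁|x−x'|} − e^{-z₂|x−x'|}) / (4π |x − x'|) ]² d³x d³x' ≤ (‖V‖₁² / (16π²)) (z₂² − z₁²). Consequently the two-particle Birman–Schwinger operator on L²(ℝ³) with integral kernel √(V(x)V(x')) e^{-z|x−x'|}/(4π|x−x'|) satisfies the Hölder continuity estimate ‖C(z₁) − C(z₂)‖ ≤ (‖V‖₁/(4π)) √(z₂² − z₁²) in Hilbert–Schmidt (hence operator) norm. -/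

import Mathlib

open MeasureTheory Real

noncomputable section

/-- Euclidean three-dimensional space. -/
abbrev E3 := EuclideanSpace ℝ (Fin 3)

/-- The Hilbert space `L²(ℝ³)`. -/
abbrev L2R3 := Lp ℂ 2 (volume : Measure E3)

theorem abs_exp_sub_exp_div_le {a b r : ℝ} (ha : 0 < a) (hab : a < b) (hr : 0 ≤ r) :
    |(Real.exp (-(a * r)) - Real.exp (-(b * r))) / (4 * π * r)| ≤
      Real.sqrt (b ^ 2 - a ^ 2) / (4 * π) := by
  rcases hr.eq_or_lt with rfl | hr
  · simp; positivity
  have h₁ : Real.exp (-(b * r)) ≤ Real.exp (-(a * r)) := by gcongr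
  have h₂ : Real.exp (-(a * r)) - Real.exp (-(b * r)) ≤ (b - a) * r := by
    have e : Real.exp (-(b * r)) = Real.exp (-(a * r)) * Real.exp (-((b - a) * r)) := by
      rw [← Real.exp_add]; ring_nf
    have h₃ : Real.exp (-(a * r)) ≤ 1 := Real.exp_le_one_iff.2 (by nlinarith)
    have h₄ := Real.add_one_le_exp (-((b - a) * r))
    have h₅ := Real.exp_pos (-(a * r))
    have h₆ : 0 ≤ (b - a) * r := by nlinarith
    rw [e]
    nlinarith
  have h₃ : b - a ≤ Real.sqrt (b ^ 2 - a ^ 2) := Real.le_sqrt_of_sq_le (by nlinarith)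
  rw [abs_of_nonneg (div_nonneg (sub_nonneg.2 h₁) (by positivity)),
    div_le_div_iff₀ (by positivity) (by positivity)]
  have h₄ := h₂.trans (mul_le_mul_of_nonneg_right h₃ hr.le)
  nlinarith [Real.pi_pos]

theorem integrable_exp_neg_mul_norm_div {z : ℝ} (hz : 0 < z) :
    Integrable (fun y : E3 => Real.exp (-(z * ‖y‖)) / (4 * π * ‖y‖)) := by
  refine (integrable_fun_norm_addHaar (μ := (volume : Measure E3))
    (f := fun r : ℝ => Real.exp (-(z * r)) / (4 * π * r))).2 ?_
  have h := (integrableOn_rpow_mul_exp_neg_mul_rpow (s := 1) (p := 1) (b := z)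
    (by norm_num) (by norm_num) hz).const_mul (1 / (4 * π))
  refine IntegrableOn.congr_fun h (fun r hr => ?_) measurableSet_Ioi
  have hr' : r ≠ 0 := ne_of_gt hr
  simp only [finrank_euclideanSpace, Fintype.card_fin, Real.rpow_one, smul_eq_mul]
  field_simp

theorem memLp_two_sqrt {V : E3 → ℝ} (hV : Integrable V) (hpos : ∀ᵐ x : E3, 0 ≤ V x) :
    MemLp (fun x => Real.sqrt (V x)) 2 := by
  refine (memLp_two_iff_integrable_sq
    (Real.continuous_sqrt.comp_aestronglyMeasurable hV.1)).2 ?_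
  refine hV.congr ?_
  filter_upwards [hpos] with x hx
  exact (Real.sq_sqrt hx).symm

theorem norm_toLp_sqrt_sq {V : E3 → ℝ} (hV : Integrable V) (hpos : ∀ᵐ x : E3, 0 ≤ V x) :
    ‖(memLp_two_sqrt hV hpos).toLp‖ ^ 2 = ∫ x, V x := by
  rw [← real_inner_self_eq_norm_sq, L2.inner_def]
  refine integral_congr_ae ?_
  filter_upwards [hpos, (memLp_two_sqrt hV hpos).coeFn_toLp] with x hx h
  rw [h, real_inner_self_eq_norm_sq, Real.norm_eq_abs, sq_abs, Real.sq_sqrt hx]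

theorem integral_sqrt_mul_norm_le {V : E3 → ℝ} (hV : Integrable V)
    (hpos : ∀ᵐ x : E3, 0 ≤ V x) (φ : L2R3) :
    ∫ x, Real.sqrt (V x) * ‖φ x‖ ≤ ‖(memLp_two_sqrt hV hpos).toLp‖ * ‖φ‖ := by
  have hφ := (Lp.memLp φ).norm
  have hn : ‖hφ.toLp‖ = ‖φ‖ := by
    rw [Lp.norm_toLp, eLpNorm_norm, Lp.norm_def]
  rw [← hn]
  refine le_trans (le_of_eq ?_) (real_inner_le_norm _ _)
  rw [L2.inner_def]
  refine integral_congr_ae ?_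
  filter_upwards [hφ.coeFn_toLp, (memLp_two_sqrt hV hpos).coeFn_toLp] with x h h'
  rw [h, h']
  simp [mul_comm]

theorem ae_integrable_kernel_mul {V : E3 → ℝ} (hV : Integrable V)
    (hpos : ∀ᵐ x : E3, 0 ≤ V x) {z : ℝ} (hz : 0 < z) (φ : L2R3) :
    ∀ᵐ x : E3, Integrable fun x' : E3 =>
      ((Real.sqrt (V x * V x') * Real.exp (-(z * ‖x - x'‖)) /
        (4 * π * ‖x - x'‖) : ℝ) : ℂ) * φ x' := by
  have hφ : Integrable (fun x => (Real.sqrt (V x)) • φ x) :=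
    memLp_one_iff_integrable.1 ((Lp.memLp φ).smul (memLp_two_sqrt hV hpos))
  filter_upwards [hpos, hφ.ae_convolution_exists
    ((ContinuousLinearMap.lsmul ℝ ℝ : ℝ →L[ℝ] ℂ →L[ℝ] ℂ).flip)
    (integrable_exp_neg_mul_norm_div hz)] with x hx h
  have h' := Integrable.const_mul (c := ((Real.sqrt (V x) : ℝ) : ℂ)) h
  refine h'.congr (Filter.Eventually.of_forall fun x' => ?_)
  simp only [ContinuousLinearMap.flip_apply, ContinuousLinearMap.lsmul_apply,
    Complex.real_smul, Real.sqrt_mul hx]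
  push_cast
  ring

/-- the continuity estimate (sukref7) of Lemma 7.5(a) of the
paper, two-particle form.  For `V ∈ L¹(ℝ³)`, `V ≥ 0` a.e., and
`0 < z₁ < z₂`, the squared Hilbert–Schmidt norm of the kernel difference is
bounded by `‖V‖₁² (z₂² − z₁²)/(16π²)`; consequently any bounded operators
`C(z₁)`, `C(z₂)` on `L²(ℝ³)` given by the Birman–Schwinger kernels
`√(V(x)V(x')) e^{−z|x−x'|}/(4π|x−x'|)` satisfy
`‖C(z₁) − C(z₂)‖ ≤ (‖V‖₁/(4π)) √(z₂² − z₁²)`. -/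
theorem statement12 (V : E3 → ℝ) (hV : Integrable V)
    (hpos : ∀ᵐ x : E3, 0 ≤ V x)
    (z₁ z₂ : ℝ) (hz₁ : 0 < z₁) (hz₁₂ : z₁ < z₂)
    (C₁ C₂ : L2R3 →L[ℂ] L2R3)
    (hC₁ : ∀ φ : L2R3, (C₁ φ : E3 → ℂ) =ᵐ[volume] fun x =>
      ∫ x' : E3, ((Real.sqrt (V x * V x') * Real.exp (-(z₁ * ‖x - x'‖)) /
        (4 * π * ‖x - x'‖) : ℝ) : ℂ) * φ x')
    (hC₂ : ∀ φ : L2R3, (C₂ φ : E3 → ℂ) =ᵐ[volume] fun x =>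
      ∫ x' : E3, ((Real.sqrt (V x * V x') * Real.exp (-(z₂ * ‖x - x'‖)) /
        (4 * π * ‖x - x'‖) : ℝ) : ℂ) * φ x') :
    (∫ x : E3, ∫ x' : E3, V x * V x' *
        ((Real.exp (-(z₁ * ‖x - x'‖)) - Real.exp (-(z₂ * ‖x - x'‖))) /
          (4 * π * ‖x - x'‖)) ^ 2)
      ≤ (∫ x : E3, V x) ^ 2 / (16 * π ^ 2) * (z₂ ^ 2 - z₁ ^ 2) ∧
    ‖C₁ - C₂‖ ≤ (∫ x : E3, V x) / (4 * π) * Real.sqrt (z₂ ^ 2 - z₁ ^ 2) := by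
  have hc : 0 ≤ Real.sqrt (z₂ ^ 2 - z₁ ^ 2) / (4 * π) := by positivity
  have hK (x x' : E3) := abs_exp_sub_exp_div_le hz₁ hz₁₂ (norm_nonneg (x - x'))
  have hs : Real.sqrt (z₂ ^ 2 - z₁ ^ 2) ^ 2 = z₂ ^ 2 - z₁ ^ 2 :=
    Real.sq_sqrt (by nlinarith)
  set c : ℝ := Real.sqrt (z₂ ^ 2 - z₁ ^ 2) / (4 * π) with hcdef
  constructor
  · have hrhs : (∫ x : E3, V x) ^ 2 / (16 * π ^ 2) * (z₂ ^ 2 - z₁ ^ 2) =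
        ∫ x : E3, V x * ((∫ x', V x') * c ^ 2) := by
      rw [integral_mul_const, hcdef, div_pow, hs]
      ring
    rw [hrhs]
    refine integral_mono_of_nonneg ?_ (hV.mul_const _) ?_
    · filter_upwards [hpos] with x hx
      refine integral_nonneg_of_ae ?_
      filter_upwards [hpos] with x' hx'
      exact mul_nonneg (mul_nonneg hx hx') (sq_nonneg _)
    · filter_upwards [hpos] with x hx
      have e : V x * ((∫ x', V x') * c ^ 2) = ∫ x', V x * V x' * c ^ 2 := by
        rw [integral_mul_const, integral_const_mul, mul_assoc]
      simp only [e]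
      refine integral_mono_of_nonneg ?_ ((hV.const_mul _).mul_const _) ?_
      · filter_upwards [hpos] with x' hx'
        exact mul_nonneg (mul_nonneg hx hx') (sq_nonneg _)
      · filter_upwards [hpos] with x' hx'
        exact mul_le_mul_of_nonneg_left (sq_le_sq.2 ((hK x x').trans (le_abs_self c)))
          (mul_nonneg hx hx')
  · have hV0 : 0 ≤ ∫ x : E3, V x := integral_nonneg_of_ae hpos
    refine ContinuousLinearMap.opNorm_le_bound _ (by positivity) fun φ => ?_
    set g := (memLp_two_sqrt hV hpos).toLp with hg
    have hint : Integrable (fun x => Real.sqrt (V x) * ‖φ x‖) :=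
      (memLp_two_sqrt hV hpos).integrable_mul (Lp.memLp φ).norm
    have key : ∀ᵐ x : E3, ‖(C₁ - C₂) φ x‖ ≤ (c * (‖g‖ * ‖φ‖)) * ‖g x‖ := by
      have hsub : ((C₁ - C₂) φ : E3 → ℂ) =ᵐ[volume] C₁ φ - C₂ φ := by
        rw [sub_apply]
        exact Lp.coeFn_sub _ _
      filter_upwards [hpos, hsub, hC₁ φ, hC₂ φ, (memLp_two_sqrt hV hpos).coeFn_toLp,
        ae_integrable_kernel_mul hV hpos hz₁ φ,
        ae_integrable_kernel_mul hV hpos (hz₁.trans hz₁₂) φ] with x hx h h₁ h₂ hgx i₁ i₂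
      rw [h, Pi.sub_apply, h₁, h₂, ← integral_sub i₁ i₂, hg, hgx, Real.norm_eq_abs,
        abs_of_nonneg (Real.sqrt_nonneg _)]
      calc _ ≤ ∫ x', c * Real.sqrt (V x) * (Real.sqrt (V x') * ‖φ x'‖) := by
            refine norm_integral_le_of_norm_le (hint.const_mul _) (.of_forall fun x' => ?_)
            rw [← sub_mul, ← Complex.ofReal_sub, norm_mul, Complex.norm_real, Real.norm_eq_abs,
              ← sub_div, ← mul_sub, mul_div_assoc, abs_mul, abs_of_nonneg (Real.sqrt_nonneg _),
              Real.sqrt_mul hx]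
            calc _ ≤ Real.sqrt (V x) * Real.sqrt (V x') * c * ‖φ x'‖ := by
                  gcongr
                  exact hK x x'
              _ = _ := by ring
        _ = c * Real.sqrt (V x) * ∫ x', Real.sqrt (V x') * ‖φ x'‖ := integral_const_mul _ _
        _ ≤ c * Real.sqrt (V x) * (‖g‖ * ‖φ‖) := by
            gcongr
            exact integral_sqrt_mul_norm_le hV hpos φ
        _ = _ := by ring
    refine (Lp.norm_le_mul_norm_of_ae_le_mul key).trans_eq ?_
    rw [← norm_toLp_sqrt_sq hV hpos, ← hg, hcdef]
    ring

end
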